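/- arXiv:0910.5944 — 3 statements merged into one kernel-verified Lean document; each statement's English description precedes it below -/
import Mathlib

section
/- Let n ≥ 1 and M ≥ 1 be integers, let m^{(1)}, …, m^{(M)} ∈ ℤⁿ and ε₁, …, ε_M ∈ ℤ, and for x ∈ (ℂ ∖ {0})ⁿ write x^{m} = ∏_{j=1}^{n} x_j^{m_j}. For 1 ≤ i ≤ n define the q-certificate h_i(x;q;p) = ∏_{a=1}^{M} θ(x^{m^{(a)}};p;q)_{m_i^{(a)}}^{ε_a}. Suppose ∑_{a=1}^{M} ε_a m_i^{(a)} m_j^{(a)} m_k^{(a)} = 0 and ∑_{a=1}^{M} ε_a m_i^{(a)} m_j^{(a)} = 0 for all 1 ≤ i, j, k ≤ n. Then for all 1 ≤ i, j ≤ n and all x ∈ (ℂ ∖ {0})ⁿ, q ∈ ℂ ∖ {0}, p with 0 < |p| < 1 at which all theta factors occurring with negative exponent are nonzero, h_i(x₁, …, p·x_j, …, x_n; q; p) = h_i(x₁, …, x_n; q; p). If moreover ∑_{a=1}^{M} ε_a m_i^{(a)} = 0 for all i, then also h_i(x; pq; p) = h_i(x; q; p). -/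
open scoped BigOperators

/-- The infinite q-Pochhammer symbol `(x;p)_∞ = ∏_{j≥0} (1 - x p^j)`. -/
noncomputable def pochInf (x p : ℂ) : ℂ := ∏' j : ℕ, (1 - x * p ^ j)

/-- The theta function `θ(x;p) = (x;p)_∞ (p x⁻¹;p)_∞`. -/
noncomputable def theta (x p : ℂ) : ℂ := pochInf x p * pochInf (p * x⁻¹) p

/-- The elliptic shifted factorial `θ(x;p;q)_n` for `n : ℤ`. -/
noncomputable def thetaPoch (x p q : ℂ) (n : ℤ) : ℂ :=
  if 0 ≤ n then ∏ j ∈ Finset.range n.toNat, theta (x * q ^ j) p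
  else ∏ j ∈ Finset.range (-n).toNat, (theta (x * q ^ (-((j : ℤ) + 1))) p)⁻¹

/-- The monomial `x^m = ∏_j x_j^{m_j}`. -/
noncomputable def xmon {n : ℕ} (x : Fin n → ℂ) (m : Fin n → ℤ) : ℂ := ∏ j, x j ^ m j

/-- The `q`-certificate `h_i(x;q;p) = ∏_a θ(x^{m^{(a)}};p;q)_{m_i^{(a)}}^{ε_a}`. -/
noncomputable def cert {n M : ℕ} (m : Fin M → Fin n → ℤ) (ε : Fin M → ℤ)
    (x : Fin n → ℂ) (q p : ℂ) (i : Fin n) : ℂ :=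
  ∏ a, thetaPoch (xmon x (m a)) p q (m a i) ^ ε a


lemma pochInf_step (x p : ℂ) (hp : ‖p‖ < 1) :
    pochInf x p = (1 - x) * pochInf (p * x) p := by
  have hs : Summable (fun j : ℕ => ‖-(p * x * p ^ j)‖) := by
    simp only [norm_neg, norm_mul, norm_pow]
    exact (summable_geometric_of_lt_one (norm_nonneg _) hp).mul_left _
  have hm : Multipliable (fun j : ℕ => 1 - p * x * p ^ j) := by
    simpa [sub_eq_add_neg] using multipliable_one_add_of_summable hs
  have e : ∀ j : ℕ, 1 - p * x * p ^ j = 1 - x * p ^ (j + 1) := fun j => by ring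
  simp only [e] at hm
  have h := tprod_eq_zero_mul' (f := fun j : ℕ => 1 - x * p ^ j) hm
  simp only [pow_zero, mul_one] at h
  unfold pochInf
  rw [h]
  simp only [e]

lemma theta_step (x p : ℂ) (hx : x ≠ 0) (hp0 : p ≠ 0) (hp : ‖p‖ < 1) :
    theta (p * x) p = (-x)⁻¹ * theta x p := by
  unfold theta
  have h1 : p * (p * x)⁻¹ = x⁻¹ := by field_simp
  rw [h1, pochInf_step x p hp, pochInf_step x⁻¹ p hp]
  field_simp
  ring

/-- binomial coefficient `N(N-1)/2` on the integers -/
def ctwo (N : ℤ) : ℤ := N * (N - 1) / 2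

/-- binomial coefficient `N(N-1)(N-2)/6` on the integers -/
def cthree (N : ℤ) : ℤ := N * (N - 1) * (N - 2) / 6

lemma ctwo_spec (N : ℤ) : 2 * ctwo N = N * (N - 1) := by
  unfold ctwo
  apply Int.mul_ediv_cancel'
  have := Int.even_mul_pred_self N
  exact this.two_dvd

lemma ctwo_succ (N : ℤ) : ctwo (N + 1) = ctwo N + N := by
  have h1 := ctwo_spec N
  have h2 := ctwo_spec (N + 1)
  have : 2 * ctwo (N + 1) = 2 * (ctwo N + N) := by rw [h2, mul_add, h1]; ring
  omega

lemma cthree_spec (N : ℤ) : 6 * cthree N = N * (N - 1) * (N - 2) := by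
  unfold cthree
  apply Int.mul_ediv_cancel'
  have h2 : (2 : ℤ) ∣ N * (N - 1) * (N - 2) :=
    Dvd.dvd.mul_right (Int.even_mul_pred_self N).two_dvd _
  have h3 : (3 : ℤ) ∣ N * (N - 1) * (N - 2) := by
    have : N % 3 = 0 ∨ N % 3 = 1 ∨ N % 3 = 2 := by omega
    rcases this with h | h | h
    · exact Dvd.dvd.mul_right (Dvd.dvd.mul_right (by omega) _) _
    · exact Dvd.dvd.mul_right (Dvd.dvd.mul_left (by omega) _) _
    · exact Dvd.dvd.mul_left (by omega) _
  omega

lemma cthree_succ (N : ℤ) : cthree (N + 1) = cthree N + ctwo N := by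
  have h1 := cthree_spec N
  have h2 := cthree_spec (N + 1)
  have h3 := ctwo_spec N
  have : 6 * cthree (N + 1) = 6 * (cthree N + ctwo N) := by
    linear_combination h2 - h1 - 3 * h3
  omega

lemma theta_zpow (x p : ℂ) (hx : x ≠ 0) (hp0 : p ≠ 0) (hp : ‖p‖ < 1) (l : ℤ) :
    theta (p ^ l * x) p = (-x) ^ (-l) * p ^ (-ctwo l) * theta x p := by
  have hx' : -x ≠ 0 := neg_ne_zero.mpr hx
  have key : ∀ l : ℤ, theta (p ^ (l + 1) * x) p
      = (-x)⁻¹ * p ^ (-l) * theta (p ^ l * x) p := by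
    intro l
    have h := theta_step (p ^ l * x) p (mul_ne_zero (zpow_ne_zero _ hp0) hx) hp0 hp
    rw [← mul_assoc, ← zpow_one_add₀ hp0, add_comm] at h
    rw [h, zpow_neg, ← mul_neg, mul_inv]
    ring
  have coef : ∀ l : ℤ, (-x) ^ (-(l + 1)) * p ^ (-ctwo (l + 1))
      = (-x)⁻¹ * p ^ (-l) * ((-x) ^ (-l) * p ^ (-ctwo l)) := by
    intro l
    rw [ctwo_succ, neg_add, neg_add, zpow_add₀ hx', zpow_add₀ hp0, zpow_neg_one]
    ring
  induction l using Int.induction_on with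
  | zero => simp [ctwo]
  | succ k ih => rw [key, coef, ih]; ring
  | pred k ih =>
    have h1 := key (-(k : ℤ) - 1)
    have h2 := coef (-(k : ℤ) - 1)
    rw [sub_add_cancel] at h1 h2
    rw [h1, h2] at ih
    have hne : (-x)⁻¹ * p ^ (-(-(k : ℤ) - 1)) ≠ 0 :=
      mul_ne_zero (inv_ne_zero hx') (zpow_ne_zero _ hp0)
    apply mul_left_cancel₀ hne
    rw [ih]; ring

lemma thetaPoch_scale (x y p q q' : ℂ) (F G : ℤ → ℂ) (hG0 : G 0 = 1)
    (hF : ∀ j, F j ≠ 0) (hG : ∀ j, G (j + 1) = G j * F j)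
    (h : ∀ j : ℤ, theta (y * q' ^ j) p = F j * theta (x * q ^ j) p) (N : ℤ) :
    thetaPoch y p q' N = G N * thetaPoch x p q N := by
  unfold thetaPoch
  split_ifs with hN
  · obtain ⟨k, rfl⟩ := Int.eq_ofNat_of_zero_le hN
    simp only [Int.toNat_natCast]
    clear hN
    induction k with
    | zero => simp [hG0]
    | succ k ih =>
      have hk := h k
      simp only [zpow_natCast] at hk
      rw [Finset.prod_range_succ, Finset.prod_range_succ, ih, hk]
      push_cast
      rw [hG]; ring
  · obtain ⟨k, hk⟩ := Int.eq_ofNat_of_zero_le (by omega : 0 ≤ -N)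
    obtain rfl : N = -(k : ℤ) := by omega
    simp only [neg_neg, Int.toNat_natCast]
    clear hN hk
    induction k with
    | zero => simp [hG0]
    | succ k ih =>
      rw [Finset.prod_range_succ, Finset.prod_range_succ, ih, h]
      have e := hG (-((k : ℤ) + 1))
      rw [show -((k : ℤ) + 1) + 1 = -(k : ℤ) by ring] at e
      push_cast
      rw [e, mul_inv]
      have := hF (-((k : ℤ) + 1))
      field_simp

lemma thetaPoch_shift_x (x p q : ℂ) (hx : x ≠ 0) (hq : q ≠ 0) (hp0 : p ≠ 0) (hp : ‖p‖ < 1)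
    (l N : ℤ) : thetaPoch (p ^ l * x) p q N =
      ((-x) ^ (-(l * N)) * q ^ (-(l * ctwo N)) * p ^ (-(N * ctwo l))) * thetaPoch x p q N := by
  have hx' : -x ≠ 0 := neg_ne_zero.mpr hx
  refine thetaPoch_scale x (p ^ l * x) p q q
    (fun j => (-x) ^ (-l) * q ^ (-(l * j)) * p ^ (-ctwo l))
    (fun N => (-x) ^ (-(l * N)) * q ^ (-(l * ctwo N)) * p ^ (-(N * ctwo l))) ?_ ?_ ?_ ?_ N
  · simp [ctwo]
  · intro j
    exact mul_ne_zero (mul_ne_zero (zpow_ne_zero _ hx') (zpow_ne_zero _ hq)) (zpow_ne_zero _ hp0)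
  · intro j
    simp only [ctwo_succ, mul_add, add_mul, neg_add, zpow_add₀ hx', zpow_add₀ hq, zpow_add₀ hp0,
      mul_one, one_mul]
    ring
  · intro j
    rw [mul_assoc, theta_zpow _ p (mul_ne_zero hx (zpow_ne_zero _ hq)) hp0 hp, ← neg_mul,
      mul_zpow, ← zpow_mul]
    simp only [mul_neg, mul_comm j l]

lemma thetaPoch_shift_q (x p q : ℂ) (hx : x ≠ 0) (hq : q ≠ 0) (hp0 : p ≠ 0) (hp : ‖p‖ < 1)
    (N : ℤ) : thetaPoch x p (p * q) N =
      ((-x) ^ (-(ctwo N)) * q ^ (-(2 * cthree N + ctwo N)) * p ^ (-(cthree N)))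
        * thetaPoch x p q N := by
  have hx' : -x ≠ 0 := neg_ne_zero.mpr hx
  refine thetaPoch_scale x x p q (p * q)
    (fun j => (-x) ^ (-j) * q ^ (-(j * j)) * p ^ (-ctwo j))
    (fun N => (-x) ^ (-(ctwo N)) * q ^ (-(2 * cthree N + ctwo N)) * p ^ (-(cthree N)))
    ?_ ?_ ?_ ?_ N
  · simp [ctwo, cthree]
  · intro j
    exact mul_ne_zero (mul_ne_zero (zpow_ne_zero _ hx') (zpow_ne_zero _ hq)) (zpow_ne_zero _ hp0)
  · intro j
    have e : -(2 * cthree (j + 1) + ctwo (j + 1)) = -(2 * cthree j + ctwo j) + -(j * j) := by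
      rw [cthree_succ, ctwo_succ]
      linear_combination - ctwo_spec j
    simp only [e]
    simp only [ctwo_succ, cthree_succ, neg_add _ j, neg_add _ (ctwo j), zpow_add₀ hx',
      zpow_add₀ hq _ (-(j * j)), zpow_add₀ hp0]
    rw [← neg_add]
    ring
  · intro j
    rw [mul_zpow, mul_left_comm, theta_zpow _ p (mul_ne_zero hx (zpow_ne_zero _ hq)) hp0 hp,
      ← neg_mul, mul_zpow, ← zpow_mul]
    simp only [mul_neg]

lemma prod_zpow_sum {ι : Type*} (s : Finset ι) (c : ℂ) (hc : c ≠ 0) (f : ι → ℤ) :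
    ∏ a ∈ s, c ^ f a = c ^ ∑ a ∈ s, f a := by
  classical
  induction s using Finset.induction_on with
  | empty => simp
  | insert a s ha ih => rw [Finset.prod_insert ha, Finset.sum_insert ha, ih, zpow_add₀ hc]

lemma xmon_ne_zero {n : ℕ} (x : Fin n → ℂ) (m : Fin n → ℤ) (hx : ∀ l, x l ≠ 0) :
    xmon x m ≠ 0 := Finset.prod_ne_zero_iff.mpr fun l _ => zpow_ne_zero _ (hx l)

lemma xmon_update {n : ℕ} (x : Fin n → ℂ) (m : Fin n → ℤ) (j : Fin n) (p : ℂ) :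
    xmon (Function.update x j (p * x j)) m = p ^ m j * xmon x m := by
  unfold xmon
  rw [← Finset.mul_prod_erase _ _ (Finset.mem_univ j),
    ← Finset.mul_prod_erase _ (fun k => x k ^ m k) (Finset.mem_univ j)]
  rw [Function.update_self, mul_zpow, mul_assoc]
  congr 2
  apply Finset.prod_congr rfl
  intro k hk
  rw [Function.update_of_ne (Finset.ne_of_mem_erase hk)]

lemma prod_factor {n M : ℕ} (m : Fin M → Fin n → ℤ) (ε : Fin M → ℤ) (x : Fin n → ℂ) (q p : ℂ)
    (hx : ∀ l, x l ≠ 0) (hq : q ≠ 0) (hp0 : p ≠ 0) (A B C : Fin M → ℤ)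
    (hA : ∑ a, A a * ε a = 0) (hAm : ∀ k, ∑ a, m a k * (A a * ε a) = 0)
    (hB : ∑ a, B a * ε a = 0) (hC : ∑ a, C a * ε a = 0) :
    ∏ a, ((-xmon x (m a)) ^ A a * q ^ B a * p ^ C a) ^ ε a = 1 := by
  have hX : ∏ a, xmon x (m a) ^ (A a * ε a) = 1 := by
    simp only [xmon, ← Finset.prod_zpow, ← zpow_mul]
    rw [Finset.prod_comm]
    apply Finset.prod_eq_one
    intro k _
    rw [prod_zpow_sum _ _ (hx k), hAm, zpow_zero]
  have : ∀ a, ((-xmon x (m a)) ^ A a * q ^ B a * p ^ C a) ^ ε a =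
      (-1 : ℂ) ^ (A a * ε a) * xmon x (m a) ^ (A a * ε a) * q ^ (B a * ε a) * p ^ (C a * ε a) := by
    intro a
    rw [neg_eq_neg_one_mul]
    simp only [mul_zpow, zpow_mul]
  simp only [this, Finset.prod_mul_distrib]
  rw [hX, prod_zpow_sum _ _ (by norm_num), prod_zpow_sum _ _ hq, prod_zpow_sum _ _ hp0, hA, hB, hC]
  simp

/-- Total ellipticity of the `q`-certificates of a totally elliptic hypergeometric
term: under the Diophantine conditions on the exponents `m^{(a)}, ε_a`, the
certificates `h_i` are `p`-elliptic in every variable `x_j`, and under the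
additional linear condition they are also `p`-elliptic in `q`. -/
theorem certificates_total_ellipticity (n M : ℕ) (hn : 1 ≤ n) (hM : 1 ≤ M)
    (m : Fin M → Fin n → ℤ) (ε : Fin M → ℤ)
    (hcube : ∀ i j k : Fin n, ∑ a, ε a * m a i * m a j * m a k = 0)
    (hsq : ∀ i j : Fin n, ∑ a, ε a * m a i * m a j = 0) :
    (∀ (i j : Fin n) (x : Fin n → ℂ) (q p : ℂ),
        (∀ l, x l ≠ 0) → q ≠ 0 → 0 < ‖p‖ → ‖p‖ < 1 →
        (∀ a : Fin M, ε a * m a i < 0 →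
          ∀ k l : ℤ, theta (p ^ l * q ^ k * xmon x (m a)) p ≠ 0) →
        cert m ε (Function.update x j (p * x j)) q p i = cert m ε x q p i) ∧
    ((∀ i : Fin n, ∑ a, ε a * m a i = 0) →
      ∀ (i : Fin n) (x : Fin n → ℂ) (q p : ℂ),
        (∀ l, x l ≠ 0) → q ≠ 0 → 0 < ‖p‖ → ‖p‖ < 1 →
        (∀ a : Fin M, ε a * m a i < 0 →
          ∀ k l : ℤ, theta (p ^ l * q ^ k * xmon x (m a)) p ≠ 0) →
        cert m ε x (p * q) p i = cert m ε x q p i) := by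
  constructor
  · intro i j x q p hx hq hp0 hp _
    have hp0' : p ≠ 0 := norm_pos_iff.mp hp0
    unfold cert
    have h : ∀ a, thetaPoch (xmon (Function.update x j (p * x j)) (m a)) p q (m a i) ^ ε a = _ :=
      fun a => by
        rw [xmon_update, thetaPoch_shift_x _ p q (xmon_ne_zero x (m a) hx) hq hp0' hp, mul_zpow]
    simp only [h, Finset.prod_mul_distrib (f := fun a => (_ * _) ^ ε a)]
    rw [prod_factor m ε x q p hx hq hp0', one_mul]
    · have := hsq i j
      rw [← neg_eq_zero, ← this, ← Finset.sum_neg_distrib]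
      exact Finset.sum_congr rfl fun a _ => by ring
    · intro k
      have := hcube i j k
      rw [← neg_eq_zero, ← this, ← Finset.sum_neg_distrib]
      exact Finset.sum_congr rfl fun a _ => by ring
    · have h2 : 2 * ∑ a, -(m a j * ctwo (m a i)) * ε a
          = -∑ a, ε a * m a i * m a i * m a j + ∑ a, ε a * m a i * m a j := by
        rw [Finset.mul_sum, ← Finset.sum_neg_distrib, ← Finset.sum_add_distrib]
        exact Finset.sum_congr rfl fun a _ => by
          linear_combination (-(m a j) * ε a) * ctwo_spec (m a i)
      rw [hcube, hsq] at h2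
      omega
    · have h2 : 2 * ∑ a, -(m a i * ctwo (m a j)) * ε a
          = -∑ a, ε a * m a i * m a j * m a j + ∑ a, ε a * m a i * m a j := by
        rw [Finset.mul_sum, ← Finset.sum_neg_distrib, ← Finset.sum_add_distrib]
        exact Finset.sum_congr rfl fun a _ => by
          linear_combination (-(m a i) * ε a) * ctwo_spec (m a j)
      rw [hcube, hsq] at h2
      omega
  · intro hlin i x q p hx hq hp0 hp _
    have hp0' : p ≠ 0 := norm_pos_iff.mp hp0
    have s2 : ∑ a, ctwo (m a i) * ε a = 0 := by
      have h2 : 2 * ∑ a, ctwo (m a i) * ε a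
          = ∑ a, ε a * m a i * m a i - ∑ a, ε a * m a i := by
        rw [Finset.mul_sum, ← Finset.sum_sub_distrib]
        exact Finset.sum_congr rfl fun a _ => by
          linear_combination (ε a) * ctwo_spec (m a i)
      rw [hlin, hsq] at h2
      omega
    have s3 : ∑ a, cthree (m a i) * ε a = 0 := by
      have h2 : 6 * ∑ a, cthree (m a i) * ε a
          = ∑ a, ε a * m a i * m a i * m a i - 3 * ∑ a, ε a * m a i * m a i
            + 2 * ∑ a, ε a * m a i := by
        rw [Finset.mul_sum, Finset.mul_sum, Finset.mul_sum, ← Finset.sum_sub_distrib,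
          ← Finset.sum_add_distrib]
        exact Finset.sum_congr rfl fun a _ => by
          linear_combination (ε a) * cthree_spec (m a i)
      rw [hlin, hsq, hcube] at h2
      omega
    unfold cert
    have h : ∀ a, thetaPoch (xmon x (m a)) p (p * q) (m a i) ^ ε a = _ :=
      fun a => by
        rw [thetaPoch_shift_q _ p q (xmon_ne_zero x (m a) hx) hq hp0' hp, mul_zpow]
    simp only [h, Finset.prod_mul_distrib (f := fun a => (_ * _) ^ ε a)]
    rw [prod_factor m ε x q p hx hq hp0', one_mul]
    · simp only [neg_mul, Finset.sum_neg_distrib, s2, neg_zero]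
    · intro k
      have h2 : 2 * ∑ a, m a k * (-ctwo (m a i) * ε a)
          = -∑ a, ε a * m a i * m a i * m a k + ∑ a, ε a * m a i * m a k := by
        rw [Finset.mul_sum, ← Finset.sum_neg_distrib, ← Finset.sum_add_distrib]
        exact Finset.sum_congr rfl fun a _ => by
          linear_combination (-(m a k) * ε a) * ctwo_spec (m a i)
      rw [hcube, hsq] at h2
      omega
    · simp only [neg_mul, add_mul, Finset.sum_neg_distrib, Finset.sum_add_distrib, mul_assoc,
        ← Finset.mul_sum, s2, s3]
      simp
    · simp only [neg_mul, Finset.sum_neg_distrib, s3, neg_zero]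
end

section
/- For every p ∈ ℂ with |p| < 1 and all x, y, w, z ∈ ℂ ∖ {0}, the theta functions satisfy the addition law θ(xw;p)·θ(xw^{−1};p)·θ(yz;p)·θ(yz^{−1};p) − θ(xz;p)·θ(xz^{−1};p)·θ(yw;p)·θ(yw^{−1};p) = (y/w)·θ(xy;p)·θ(xy^{−1};p)·θ(wz;p)·θ(wz^{−1};p). -/
namespace ThetaAdd

/-- Gaussian binomial coefficients. -/
noncomputable def gb (p : ℂ) : ℕ → ℕ → ℂ
  | _, 0 => 1
  | 0, _ + 1 => 0
  | M + 1, k + 1 => p ^ (k + 1) * gb p M (k + 1) + gb p M k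

/-- The finite product `(p;p)_k`. -/
noncomputable def Q (p : ℂ) (k : ℕ) : ℂ := ∏ j ∈ Finset.range k, (1 - p ^ (j + 1))

/-- The general term of the theta series, with `q ^ 2 = p`. -/
noncomputable def t (q x : ℂ) (n : ℤ) : ℂ := (-1) ^ n * q ^ (n ^ 2 - n) * x ^ n

lemma gb_zero (p : ℂ) (M : ℕ) : gb p M 0 = 1 := by cases M <;> rfl

lemma gb_succ (p : ℂ) (M k : ℕ) :
    gb p (M + 1) (k + 1) = p ^ (k + 1) * gb p M (k + 1) + gb p M k := rfl

lemma gb_of_lt (p : ℂ) (M : ℕ) : ∀ k, M < k → gb p M k = 0 := by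
  induction M with
  | zero => intro k hk; obtain ⟨k, rfl⟩ := Nat.exists_eq_succ_of_ne_zero hk.ne'; rfl
  | succ M ih =>
    intro k hk
    obtain ⟨k, rfl⟩ := Nat.exists_eq_succ_of_ne_zero (by omega : k ≠ 0)
    rw [Nat.succ_eq_add_one, gb_succ, ih _ (by omega), ih _ (by omega)]; simp

lemma Q_succ (p : ℂ) (k : ℕ) : Q p (k + 1) = Q p k * (1 - p ^ (k + 1)) := by
  simp [Q, Finset.prod_range_succ]

lemma gb_self (p : ℂ) (M : ℕ) : gb p M M = 1 := by
  induction M with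
  | zero => rfl
  | succ M ih => rw [gb_succ, gb_of_lt _ _ _ (by omega), ih]; simp

lemma gb_mul (p : ℂ) (M : ℕ) : ∀ a b, a + b = M → gb p M a * Q p a * Q p b = Q p M := by
  induction M with
  | zero =>
    intro a b h
    obtain rfl : a = 0 := by omega
    obtain rfl : b = 0 := by omega
    simp [gb_zero, Q]
  | succ M ih =>
    intro a b h
    rcases a with _ | a
    · obtain rfl : b = M + 1 := by omega
      simp [gb_zero, Q]
    rcases b with _ | b
    · obtain rfl : a = M := by omega
      rw [gb_self]; simp [Q]
    have h1 := ih (a + 1) b (by omega)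
    have h2 := ih a (b + 1) (by omega)
    have hM : M = a + b + 1 := by omega
    rw [gb_succ, Q_succ p M, Q_succ p b]
    rw [Q_succ p b] at h2
    rw [Q_succ p a] at h1 ⊢
    have : p ^ (M + 1) = p ^ (a + 1) * p ^ (b + 1) := by rw [← pow_add]; congr 1; omega
    rw [this]
    linear_combination p ^ (a + 1) * (1 - p ^ (b + 1)) * h1 + (1 - p ^ (a + 1)) * h2

lemma t_zero (q x : ℂ) : t q x 0 = 1 := by simp [t]

lemma t_mul (q p x : ℂ) (n : ℤ) :
    t q (x * p) n = p ^ n * t q x n := by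
  simp only [t, mul_zpow]; ring

lemma t_succ (q p x : ℂ) (hq : q ≠ 0) (hx : x ≠ 0) (hpq : p = q ^ 2) (n : ℤ) :
    t q x (n + 1) = - x * t q (x * p) n := by
  subst hpq
  have : (n + 1) ^ 2 - (n + 1) = (n ^ 2 - n) + (n + n) := by ring
  rw [t, t, this, zpow_add₀ hq (n ^ 2 - n), zpow_add₀ hq n n, zpow_add₀ hx,
    zpow_add₀ (by norm_num : (-1 : ℂ) ≠ 0), mul_zpow, zpow_one, zpow_one, sq q, mul_zpow]
  ring

lemma qbinom (q p : ℂ) (hq : q ≠ 0) (hpq : p = q ^ 2) (M : ℕ) : ∀ x : ℂ, x ≠ 0 →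
    ∏ j ∈ Finset.range M, (1 - x * p ^ j) =
      ∑ k ∈ Finset.range (M + 1), gb p M k * t q x k := by
  have hp : p ≠ 0 := by rw [hpq]; positivity
  induction M with
  | zero => intro x hx; simp [gb_zero, t_zero]
  | succ M ih =>
    intro x hx
    have h := ih (x * p) (mul_ne_zero hx hp)
    rw [Finset.prod_range_succ']
    have e : ∀ j : ℕ, (1 - x * p ^ (j + 1)) = 1 - (x * p) * p ^ j := by intro j; ring
    simp only [e, h]
    rw [Finset.sum_range_succ' _ (M + 1)]
    simp only [gb_succ, add_mul, Finset.sum_add_distrib, Nat.cast_add, Nat.cast_one]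
    have e1 : ∑ k ∈ Finset.range (M + 1), gb p M k * t q x ((k : ℤ) + 1) =
        - x * ∑ k ∈ Finset.range (M + 1), gb p M k * t q (x * p) k := by
      rw [Finset.mul_sum]
      refine Finset.sum_congr rfl fun k _ => ?_
      rw [t_succ q p x hq hx hpq]; ring
    have e2 : ∑ k ∈ Finset.range (M + 1), gb p M k * t q (x * p) k =
        (∑ k ∈ Finset.range (M + 1), p ^ (k + 1) * gb p M (k + 1) * t q x ((k : ℤ) + 1)) + 1 := by
      have : ∑ k ∈ Finset.range (M + 1), gb p M k * t q (x * p) k =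
        ∑ k ∈ Finset.range (M + 2), gb p M k * t q (x * p) k := by
        rw [Finset.sum_range_succ _ (M + 1), gb_of_lt p M (M + 1) (by omega)]; simp
      rw [this, Finset.sum_range_succ']
      congr 1
      · refine Finset.sum_congr rfl fun k _ => ?_
        rw [t_mul q p x]
        push_cast
        rw [show ((k : ℤ) + 1) = ((k + 1 : ℕ) : ℤ) by push_cast; rfl, zpow_natCast]; ring
      · simp [gb_zero, t_zero]
    rw [e1, gb_zero]
    simp only [Nat.cast_zero, t_zero, pow_zero]
    linear_combination e2

lemma shiftprod (q p x : ℂ) (hq : q ≠ 0) (hpq : p = q ^ 2) (hx : x ≠ 0) (N : ℕ) :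
    ∏ j ∈ Finset.range N, (1 - x * p ^ (-(N : ℤ)) * p ^ j) =
      (-x) ^ N * q ^ (-((N : ℤ) ^ 2 + N)) * ∏ j ∈ Finset.range N, (1 - p * x⁻¹ * p ^ j) := by
  have hp : p ≠ 0 := by rw [hpq]; positivity
  induction N with
  | zero => simp
  | succ N ih =>
    rw [Finset.prod_range_succ', Finset.prod_range_succ]
    have e : ∀ j : ℕ, (1 - x * p ^ (-((N + 1 : ℕ) : ℤ)) * p ^ (j + 1)) =
        1 - x * p ^ (-(N : ℤ)) * p ^ j := by
      intro j
      push_cast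
      rw [neg_add, zpow_add₀ hp, pow_succ]
      field_simp
    simp only [e, ih]
    have e3 : -(((N + 1 : ℕ) : ℤ) ^ 2 + ((N + 1 : ℕ) : ℤ)) =
      -((N : ℤ) ^ 2 + N) + -(((2 * (N + 1) : ℕ)) : ℤ) := by push_cast; ring
    rw [e3, zpow_add₀ hq, zpow_neg q ((2 * (N + 1) : ℕ) : ℤ), zpow_natCast, pow_mul, ← hpq,
      zpow_neg p, zpow_natCast]
    field_simp
    ring

lemma finite_triple (q p x : ℂ) (hq : q ≠ 0) (hpq : p = q ^ 2) (hx : x ≠ 0) (N : ℕ) :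
    (∏ j ∈ Finset.range N, (1 - x * p ^ j)) * ∏ j ∈ Finset.range N, (1 - p * x⁻¹ * p ^ j) =
      ∑ k ∈ Finset.range (2 * N + 1), gb p (2 * N) k * t q x ((k : ℤ) - N) := by
  have hp : p ≠ 0 := by rw [hpq]; positivity
  have hX : x * p ^ (-(N : ℤ)) ≠ 0 := mul_ne_zero hx (zpow_ne_zero _ hp)
  have h := qbinom q p hq hpq (2 * N) _ hX
  rw [two_mul, Finset.prod_range_add, shiftprod q p x hq hpq hx N, ← two_mul] at h
  have e : ∀ j : ℕ, (1 - x * p ^ (-(N : ℤ)) * p ^ (N + j)) = 1 - x * p ^ j := by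
    intro j
    rw [pow_add, zpow_neg, zpow_natCast]; field_simp
  simp only [e] at h
  have hc : (-x) ^ N * q ^ (-((N : ℤ) ^ 2 + N)) ≠ 0 :=
    mul_ne_zero (pow_ne_zero _ (neg_ne_zero.2 hx)) (zpow_ne_zero _ hq)
  apply mul_left_cancel₀ hc
  rw [Finset.mul_sum]
  calc _ = _ := by ring
    _ = _ := h
    _ = _ := by
      refine Finset.sum_congr rfl fun k _ => ?_
      suffices hs : t q (x * p ^ (-(N : ℤ))) k =
          (-x) ^ N * q ^ (-((N : ℤ) ^ 2 + N)) * t q x ((k : ℤ) - N) by rw [hs]; ring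
      have e1 : p ^ (-(N : ℤ)) = q ^ (-(2 * N : ℤ)) := by
        rw [hpq, ← zpow_natCast q 2, ← zpow_mul]; congr 1; push_cast; ring
      have e2 : (-x) ^ N = (-1) ^ (N : ℤ) * x ^ (N : ℤ) := by
        rw [neg_pow]; simp
      have hm : (-1 : ℂ) ≠ 0 := by norm_num
      rw [e1, e2]
      simp only [t, mul_zpow, ← zpow_mul]
      have a1 : (-1 : ℂ) ^ (k : ℤ) = (-1) ^ (N : ℤ) * (-1) ^ ((k : ℤ) - N) := by
        rw [← zpow_add₀ hm]; congr 1; ring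
      have a2 : x ^ (k : ℤ) = x ^ (N : ℤ) * x ^ ((k : ℤ) - N) := by
        rw [← zpow_add₀ hx]; congr 1; ring
      have a3 : q ^ ((k : ℤ) ^ 2 - k) * q ^ (-(2 * (N : ℤ)) * k) =
          q ^ (-((N : ℤ) ^ 2 + N)) * q ^ (((k : ℤ) - N) ^ 2 - (k - N)) := by
        rw [← zpow_add₀ hq, ← zpow_add₀ hq]; congr 1; ring
      rw [a1, a2]
      linear_combination (-1) ^ (N : ℤ) * (-1) ^ ((k : ℤ) - N) * x ^ (N : ℤ) * x ^ ((k : ℤ) - N) * a3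

lemma summable_nat (ρ r : ℝ) (h0 : 0 ≤ ρ) (h1 : ρ < 1) (hr : 0 ≤ r) :
    Summable fun n : ℕ => ρ ^ (n * n) * r ^ n := by
  have hl : Filter.Tendsto (fun n : ℕ => ρ ^ n * r) Filter.atTop (nhds 0) := by
    simpa using (tendsto_pow_atTop_nhds_zero_of_lt_one h0 h1).mul_const r
  have hev := hl.eventually (ge_mem_nhds (by norm_num : (0 : ℝ) < 1 / 2))
  refine Summable.of_norm_bounded_eventually_nat (g := fun n => (1 / 2 : ℝ) ^ n)
    (summable_geometric_of_lt_one (by norm_num) (by norm_num)) ?_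
  filter_upwards [hev] with n hn
  rw [Real.norm_of_nonneg (by positivity), pow_mul, ← mul_pow]
  exact pow_le_pow_left₀ (by positivity) hn n

/-- Gaussian series over the integers converge absolutely. -/
lemma summable_int (q x : ℂ) (hq : ‖q‖ < 1) : Summable fun n : ℤ => ‖q ^ (n ^ 2) * x ^ n‖ := by
  apply Summable.of_nat_of_neg
  · refine (summable_nat ‖q‖ ‖x‖ (norm_nonneg _) hq (norm_nonneg _)).congr fun n => ?_
    rw [norm_mul, norm_zpow, norm_zpow, ← sq, ← zpow_natCast, ← zpow_natCast]; push_cast; rfl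
  · refine (summable_nat ‖q‖ ‖x⁻¹‖ (norm_nonneg _) hq (norm_nonneg _)).congr fun n => ?_
    rw [norm_mul, norm_zpow, norm_zpow, ← sq, ← zpow_natCast, ← zpow_natCast, norm_inv, neg_sq,
      inv_zpow, zpow_neg]; push_cast; rfl

lemma summable_t (q x : ℂ) (hq0 : q ≠ 0) (hq : ‖q‖ < 1) : Summable fun n : ℤ => ‖t q x n‖ := by
  refine (summable_int q (q⁻¹ * x) hq).congr fun n => ?_
  simp only [t, norm_mul, norm_zpow, norm_neg, norm_one, one_zpow, mul_zpow, sub_eq_add_neg,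
    norm_inv, inv_zpow, zpow_add₀ (norm_ne_zero_iff.2 hq0), zpow_neg]
  ring

lemma summable_pow (p : ℂ) (hp : ‖p‖ < 1) (x : ℂ) : Summable fun j : ℕ => ‖-(x * p ^ j)‖ := by
  simp only [norm_neg, norm_mul, norm_pow]
  exact (summable_geometric_of_lt_one (norm_nonneg _) hp).mul_left _

lemma poch_tendsto (p : ℂ) (hp : ‖p‖ < 1) (x : ℂ) :
    Filter.Tendsto (fun N : ℕ => ∏ j ∈ Finset.range N, (1 - x * p ^ j)) Filter.atTop
      (nhds (pochInf x p)) := by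
  have := (multipliable_one_add_of_summable (summable_pow p hp x)).tendsto_prod_tprod_nat
  simp only [← sub_eq_add_neg] at this
  exact this

lemma one_sub_ne (p : ℂ) (hp : ‖p‖ < 1) (j : ℕ) : 1 - p * p ^ j ≠ 0 := by
  intro h
  have h1 : p ^ (j + 1) = 1 := by rw [pow_succ']; linear_combination -h
  have h2 : ‖p‖ ^ (j + 1) < 1 := pow_lt_one₀ (norm_nonneg _) hp (by omega)
  rw [← norm_pow, h1] at h2
  simp at h2

lemma Q_tendsto (p : ℂ) (hp : ‖p‖ < 1) :
    Filter.Tendsto (Q p) Filter.atTop (nhds (pochInf p p)) := by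
  have := poch_tendsto p hp p
  refine this.congr fun N => ?_
  simp only [Q, pow_succ']

lemma Q_ne (p : ℂ) (hp : ‖p‖ < 1) (k : ℕ) : Q p k ≠ 0 := by
  rw [Q, Finset.prod_ne_zero_iff]
  intro j _
  rw [pow_succ']; exact one_sub_ne p hp j

lemma Qinf_ne (p : ℂ) (hp : ‖p‖ < 1) : pochInf p p ≠ 0 := by
  have := tprod_one_add_ne_zero_of_summable (f := fun j : ℕ => -(p * p ^ j))
    (fun j => by rw [← sub_eq_add_neg]; exact one_sub_ne p hp j) (summable_pow p hp p)
  simp only [← sub_eq_add_neg] at this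
  exact this

/-- Coefficients centred at zero. -/
noncomputable def c (p : ℂ) (N : ℕ) (n : ℤ) : ℂ :=
  if 0 ≤ (N : ℤ) + n then gb p (2 * N) ((N : ℤ) + n).toNat else 0

lemma c_tendsto (p : ℂ) (hp : ‖p‖ < 1) (n : ℤ) :
    Filter.Tendsto (fun N => c p N n) Filter.atTop (nhds (pochInf p p)⁻¹) := by
  have hQ := Q_tendsto p hp
  have h1 : Filter.Tendsto (fun N : ℕ => 2 * N) Filter.atTop Filter.atTop :=
    Filter.tendsto_atTop_mono (fun N => by simp only [id]; omega) Filter.tendsto_id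
  have h2 : ∀ n : ℤ, Filter.Tendsto (fun N : ℕ => ((N : ℤ) + n).toNat) Filter.atTop Filter.atTop := by
    intro n
    rw [Filter.tendsto_atTop]
    intro b
    filter_upwards [Filter.eventually_ge_atTop (b + n.natAbs)] with N hN
    omega
  have h := (hQ.comp h1).div ((hQ.comp (h2 n)).mul (hQ.comp (h2 (-n))))
    (mul_ne_zero (Qinf_ne p hp) (Qinf_ne p hp))
  have e : pochInf p p / (pochInf p p * pochInf p p) = (pochInf p p)⁻¹ := by
    have := Qinf_ne p hp
    field_simp
  rw [e] at h
  refine h.congr' ?_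
  filter_upwards [Filter.eventually_ge_atTop n.natAbs] with N hN
  have := gb_mul p (2 * N) ((N : ℤ) + n).toNat ((N : ℤ) + -n).toNat (by omega)
  have q1 := Q_ne p hp ((N : ℤ) + n).toNat
  have q2 := Q_ne p hp ((N : ℤ) + -n).toNat
  simp only [Function.comp, c, Pi.div_apply]
  rw [if_pos (by omega), div_eq_iff (mul_ne_zero q1 q2), ← this]; ring

lemma gb_bound (p : ℂ) (hp : ‖p‖ < 1) : ∃ C : ℝ, ∀ N n, ‖c p N n‖ ≤ C := by
  have hQ := Q_tendsto p hp
  have hQi := hQ.inv₀ (Qinf_ne p hp)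
  obtain ⟨A, hA⟩ := hQ.norm.bddAbove_range
  obtain ⟨B, hB⟩ := hQi.norm.bddAbove_range
  have hA' : ∀ k, ‖Q p k‖ ≤ A := fun k => hA ⟨k, rfl⟩
  have hB' : ∀ k, ‖(Q p k)⁻¹‖ ≤ B := fun k => hB ⟨k, rfl⟩
  have hA0 : 0 ≤ A := (norm_nonneg _).trans (hA' 0)
  have hB0 : 0 ≤ B := (norm_nonneg _).trans (hB' 0)
  refine ⟨A * B * B, fun N n => ?_⟩
  rw [c]
  split_ifs with h
  · by_cases h' : ((N : ℤ) + n).toNat ≤ 2 * N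
    · have := gb_mul p (2 * N) ((N : ℤ) + n).toNat (2 * N - ((N : ℤ) + n).toNat) (by omega)
      have q1 := Q_ne p hp ((N : ℤ) + n).toNat
      have q2 := Q_ne p hp (2 * N - ((N : ℤ) + n).toNat)
      have e : gb p (2 * N) ((N : ℤ) + n).toNat = Q p (2 * N) * (Q p ((N : ℤ) + n).toNat)⁻¹ *
          (Q p (2 * N - ((N : ℤ) + n).toNat))⁻¹ := by
        rw [← this]; field_simp
      rw [e, norm_mul, norm_mul]
      gcongr
      · exact hA' _
      · exact hB' _
      · exact hB' _
    · rw [gb_of_lt _ _ _ (by omega), norm_zero]; positivity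
  · rw [norm_zero]; positivity

lemma sum_eq_tsum (q p x : ℂ) (N : ℕ) :
    ∑ k ∈ Finset.range (2 * N + 1), gb p (2 * N) k * t q x ((k : ℤ) - N) =
      ∑' n : ℤ, c p N n * t q x n := by
  have hinj : Function.Injective fun k : ℕ => (k : ℤ) - N := by
    intro a b h; simpa using h
  rw [tsum_eq_sum (s := (Finset.range (2 * N + 1)).map ⟨_, hinj⟩)]
  · rw [Finset.sum_map]
    refine Finset.sum_congr rfl fun k _ => ?_
    simp [c]
  · intro n hn
    simp only [Finset.mem_map, Finset.mem_range, Function.Embedding.coeFn_mk, not_exists,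
      not_and] at hn
    rw [c]
    split_ifs with h
    · rw [gb_of_lt, zero_mul]
      by_contra hlt
      exact hn ((N : ℤ) + n).toNat (by omega) (by omega)
    · simp

/-- The Jacobi triple product. -/
lemma triple (q p x : ℂ) (hq : q ≠ 0) (hpq : p = q ^ 2) (hx : x ≠ 0) (hp : ‖p‖ < 1)
    (hq1 : ‖q‖ < 1) : theta x p = (pochInf p p)⁻¹ * ∑' n : ℤ, t q x n := by
  obtain ⟨C, hC⟩ := gb_bound p hp
  have h1 : Filter.Tendsto (fun N : ℕ => ∑' n : ℤ, c p N n * t q x n) Filter.atTop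
      (nhds (∑' n : ℤ, (pochInf p p)⁻¹ * t q x n)) := by
    refine tendsto_tsum_of_dominated_convergence (bound := fun n => C * ‖t q x n‖)
      ((summable_t q x hq hq1).mul_left C) ?_ ?_
    · intro n
      exact (c_tendsto p hp n).mul_const _
    · refine Filter.Eventually.of_forall fun N n => ?_
      rw [norm_mul]
      exact mul_le_mul_of_nonneg_right (hC N n) (norm_nonneg _)
  have h2 := (poch_tendsto p hp x).mul (poch_tendsto p hp (p * x⁻¹))
  rw [tsum_mul_left] at h1
  refine tendsto_nhds_unique h2 (h1.congr fun N => ?_)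
  rw [← sum_eq_tsum, finite_triple q p x hq hpq hx]

/-- Parity splitting of pairs of integers. -/
def par : (ℤ × ℤ) ⊕ (ℤ × ℤ) → ℤ × ℤ :=
  Sum.elim (fun a => (a.1 + a.2, a.1 - a.2)) (fun a => (a.1 + a.2 + 1, a.1 - a.2))

lemma par_bij : Function.Bijective par := by
  constructor
  · rintro (⟨a, b⟩ | ⟨a, b⟩) (⟨a', b'⟩ | ⟨a', b'⟩) h <;>
      simp only [par, Sum.elim_inl, Sum.elim_inr, Prod.mk.injEq] at h
    · congr 2 <;> omega
    · omega
    · omega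
    · congr 2 <;> omega
  · rintro ⟨m, n⟩
    by_cases h : (m + n) % 2 = 0
    · refine ⟨Sum.inl ((m + n) / 2, (m - n) / 2), ?_⟩
      simp only [par, Sum.elim_inl, Prod.mk.injEq]; omega
    · refine ⟨Sum.inr ((m + n - 1) / 2, (m - n - 1) / 2), ?_⟩
      simp only [par, Sum.elim_inr, Prod.mk.injEq]; omega

lemma hasSum_of_eq {ι : Type} {f g : ι → ℂ} {a : ℂ} (h : HasSum g a) (e : ∀ i, f i = g i) :
    HasSum f a := by
  rwa [funext e]

noncomputable def A (q x : ℂ) : ℂ := ∑' k : ℤ, q ^ (2 * k ^ 2 - 2 * k) * x ^ (2 * k)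
noncomputable def B (q x : ℂ) : ℂ := ∑' k : ℤ, q ^ (2 * k ^ 2) * x ^ (2 * k)

lemma summable_B (q x : ℂ) (hq1 : ‖q‖ < 1) :
    Summable fun k : ℤ => ‖q ^ (2 * k ^ 2) * x ^ (2 * k)‖ := by
  have h : ‖q ^ (2 : ℤ)‖ < 1 := by
    rw [norm_zpow]; exact_mod_cast pow_lt_one₀ (norm_nonneg q) hq1 (two_ne_zero)
  refine (summable_int (q ^ (2 : ℤ)) (x ^ (2 : ℤ)) h).congr fun k => ?_
  rw [← zpow_mul, ← zpow_mul]

lemma summable_A (q x : ℂ) (hq : q ≠ 0) (hq1 : ‖q‖ < 1) :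
    Summable fun k : ℤ => ‖q ^ (2 * k ^ 2 - 2 * k) * x ^ (2 * k)‖ := by
  refine (summable_B q (q⁻¹ * x) hq1).congr fun k => ?_
  rw [mul_zpow, ← mul_assoc, inv_zpow, ← zpow_neg, ← zpow_add₀ hq, sub_eq_add_neg]

lemma T_mul (q x w : ℂ) (hq : q ≠ 0) (hq1 : ‖q‖ < 1) (hx : x ≠ 0) (hw : w ≠ 0) :
    (∑' n : ℤ, t q (x * w) n) * (∑' n : ℤ, t q (x * w⁻¹) n) =
      A q x * B q w - x * w⁻¹ * (B q x * A q w) := by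
  have s1 := summable_t q (x * w) hq hq1
  have s2 := summable_t q (x * w⁻¹) hq hq1
  rw [tsum_mul_tsum_of_summable_norm s1 s2]
  have hm : (-1 : ℂ) ≠ 0 := by norm_num
  have tt : ∀ m n : ℤ, t q (x * w) m * t q (x * w⁻¹) n =
      (-1) ^ (m + n) * q ^ (m ^ 2 + n ^ 2 - (m + n)) * x ^ (m + n) * w ^ (m - n) := by
    intro m n
    have e : m ^ 2 + n ^ 2 - (m + n) = (m ^ 2 - m) + (n ^ 2 - n) := by ring
    rw [e, zpow_add₀ hm, zpow_add₀ hq, zpow_add₀ hx, sub_eq_add_neg m n, zpow_add₀ hw]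
    simp only [t, mul_zpow, inv_zpow, zpow_neg]
    ring
  have hA := summable_A q x hq hq1
  have hB := summable_B q w hq1
  have hB' := summable_B q x hq1
  have hA' := summable_A q w hq hq1
  have H1 := (summable_mul_of_summable_norm hA hB).hasSum
  rw [← tsum_mul_tsum_of_summable_norm hA hB] at H1
  have H2 := (summable_mul_of_summable_norm hB' hA').hasSum
  rw [← tsum_mul_tsum_of_summable_norm hB' hA'] at H2
  have H3 := ((Equiv.prodCongr (Equiv.refl ℤ) (Equiv.addRight (1 : ℤ))).hasSum_iff.2 H2).mul_left
    (-(x * w⁻¹))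
  have key : HasSum ((fun a : ℤ × ℤ => t q (x * w) a.1 * t q (x * w⁻¹) a.2) ∘
      (Equiv.ofBijective par par_bij)) (A q x * B q w + -(x * w⁻¹) * (B q x * A q w)) := by
    refine HasSum.sum ?_ ?_
    · refine hasSum_of_eq H1 ?_
      rintro ⟨k, l⟩
      simp only [Function.comp, Equiv.ofBijective_apply, par, Sum.elim_inl, tt]
      rw [show k + l + (k - l) = 2 * k by ring, show k + l - (k - l) = 2 * l by ring,
        show (k + l) ^ 2 + (k - l) ^ 2 - 2 * k = (2 * k ^ 2 - 2 * k) + 2 * l ^ 2 by ring,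
        zpow_add₀ hq, zpow_mul (-1 : ℂ)]
      norm_num
      ring
    · refine hasSum_of_eq H3 ?_
      rintro ⟨k, l⟩
      simp only [Function.comp, Equiv.ofBijective_apply, par, Sum.elim_inr, tt,
        Equiv.prodCongr_apply, Prod.map, Equiv.refl_apply, Equiv.coe_addRight]
      rw [show k + l + 1 + (k - l) = 2 * k + 1 by ring,
        show k + l + 1 - (k - l) = 2 * (l + 1) + (-1) by ring,
        show (k + l + 1) ^ 2 + (k - l) ^ 2 - (2 * k + 1) =
          2 * k ^ 2 + (2 * (l + 1) ^ 2 - 2 * (l + 1)) by ring,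
        zpow_add₀ hq, zpow_add₀ hx, zpow_add₀ hw, zpow_add₀ hm, zpow_mul (-1 : ℂ)]
      norm_num
      ring
  rw [((Equiv.ofBijective par par_bij).hasSum_iff.1 key).tsum_eq]
  ring

end ThetaAdd

/-- The addition law for theta functions:
`θ(xw;p)θ(xw⁻¹;p)θ(yz;p)θ(yz⁻¹;p) − θ(xz;p)θ(xz⁻¹;p)θ(yw;p)θ(yw⁻¹;p)
  = (y/w) θ(xy;p)θ(xy⁻¹;p)θ(wz;p)θ(wz⁻¹;p)`. -/
theorem theta_addition_law (p : ℂ) (hp : ‖p‖ < 1) (x y w z : ℂ)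
    (hx : x ≠ 0) (hy : y ≠ 0) (hw : w ≠ 0) (hz : z ≠ 0) :
    theta (x * w) p * theta (x * w⁻¹) p * theta (y * z) p * theta (y * z⁻¹) p -
        theta (x * z) p * theta (x * z⁻¹) p * theta (y * w) p * theta (y * w⁻¹) p =
      y / w * (theta (x * y) p * theta (x * y⁻¹) p * theta (w * z) p * theta (w * z⁻¹) p) := by
  by_cases hp0 : p = 0
  · subst hp0
    have h0 : ∀ x : ℂ, theta x 0 = 1 - x := by
      intro x
      have e : ∀ x : ℂ, pochInf x 0 = 1 - x := by
        intro x
        rw [pochInf, tprod_eq_mulSingle 0]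
        · simp
        · intro j hj; simp [hj]
      rw [theta, e, e]; simp
    simp only [h0]
    field_simp
    ring
  obtain ⟨q, hq⟩ := IsAlgClosed.exists_pow_nat_eq p (n := 2) (by norm_num)
  have hq0 : q ≠ 0 := by rintro rfl; apply hp0; rw [← hq]; norm_num
  have hq1 : ‖q‖ < 1 := by
    rw [← hq, norm_pow] at hp
    exact (sq_lt_one_iff₀ (norm_nonneg q)).1 hp
  have F : ∀ a b : ℂ, a ≠ 0 → b ≠ 0 → theta (a * b) p * theta (a * b⁻¹) p =
      (pochInf p p)⁻¹ ^ 2 * (ThetaAdd.A q a * ThetaAdd.B q b -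
        a * b⁻¹ * (ThetaAdd.B q a * ThetaAdd.A q b)) := by
    intro a b ha hb
    rw [← ThetaAdd.T_mul q a b hq0 hq1 ha hb,
      ThetaAdd.triple q p (a * b) hq0 hq.symm (mul_ne_zero ha hb) hp hq1,
      ThetaAdd.triple q p (a * b⁻¹) hq0 hq.symm (mul_ne_zero ha (inv_ne_zero hb)) hp hq1]
    ring
  have e : ∀ a b c d : ℂ, a * b * c * d = (a * b) * (c * d) := by intros; ring
  simp only [e]
  rw [F x w hx hw, F y z hy hz, F x z hx hz, F y w hy hw, F x y hx hy, F w z hw hz]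
  generalize (pochInf p p)⁻¹ = κ
  field_simp
  ring
end

section
/- Let p, q ∈ ℂ with |p| < 1, |q| < 1 and let a, b ∈ ℂ with a² = p, b² = q. Then for every z ∈ ℂ ∖ {0} at which all factors are defined, the elliptic gamma function satisfies the duplication formula Γ(z²;p,q) = Γ(z;p,q)·Γ(−z;p,q)·Γ(bz;p,q)·Γ(−bz;p,q)·Γ(az;p,q)·Γ(−az;p,q)·Γ(abz;p,q)·Γ(−abz;p,q). -/
/-- The elliptic gamma function `Γ(z;p,q)`. -/
noncomputable def ellGamma (z p q : ℂ) : ℂ :=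
  ∏' jk : ℕ × ℕ, (1 - z⁻¹ * p ^ (jk.1 + 1) * q ^ (jk.2 + 1)) / (1 - z * p ^ jk.1 * q ^ jk.2)

/-- The double product `∏ (1 - x p^j q^k)`. -/
noncomputable def dblP (x p q : ℂ) : ℂ := ∏' jk : ℕ × ℕ, (1 - x * p ^ jk.1 * q ^ jk.2)

lemma dblP_summable (x : ℂ) {p q : ℂ} (hp : ‖p‖ < 1) (hq : ‖q‖ < 1) :
    Summable (fun jk : ℕ × ℕ => ‖-(x * p ^ jk.1 * q ^ jk.2)‖) := by
  have h := (Summable.mul_of_nonneg (summable_geometric_of_lt_one (norm_nonneg p) hp)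
    (summable_geometric_of_lt_one (norm_nonneg q) hq)
    (fun _ => by positivity) (fun _ => by positivity)).mul_left ‖x‖
  refine h.congr fun jk => ?_
  simp [mul_assoc]

lemma dblP_mult (x : ℂ) {p q : ℂ} (hp : ‖p‖ < 1) (hq : ‖q‖ < 1) :
    Multipliable (fun jk : ℕ × ℕ => (1 - x * p ^ jk.1 * q ^ jk.2)) := by
  simpa [sub_eq_add_neg] using multipliable_one_add_of_summable (dblP_summable x hp hq)

lemma dblP_ne_zero (x : ℂ) {p q : ℂ} (hp : ‖p‖ < 1) (hq : ‖q‖ < 1)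
    (h : ∀ j k : ℕ, x * p ^ j * q ^ k ≠ 1) : dblP x p q ≠ 0 := by
  have := tprod_one_add_ne_zero_of_summable
    (f := fun jk : ℕ × ℕ => -(x * p ^ jk.1 * q ^ jk.2))
    (fun jk h0 => h jk.1 jk.2 (by linear_combination -h0)) (dblP_summable x hp hq)
  simpa [dblP, sub_eq_add_neg] using this

lemma dblP_swap (x p q : ℂ) : dblP x p q = dblP x q p := by
  unfold dblP
  rw [← (Equiv.prodComm ℕ ℕ).tprod_eq]
  refine tprod_congr fun jk => ?_
  simp only [Equiv.prodComm_apply, Prod.fst_swap, Prod.snd_swap]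
  ring

lemma dblP_split (x : ℂ) {p q : ℂ} (hp : ‖p‖ < 1) (hq : ‖q‖ < 1) :
    dblP x p q = dblP x (p ^ 2) q * dblP (x * p) (p ^ 2) q := by
  have hp2 : ‖p ^ 2‖ < 1 := by
    rw [norm_pow]; exact pow_lt_one₀ (norm_nonneg _) hp (by norm_num)
  let e : (ℕ × ℕ) ⊕ (ℕ × ℕ) ≃ ℕ × ℕ :=
    (Equiv.sumProdDistrib ℕ ℕ ℕ).symm.trans
      (Equiv.prodCongr Equiv.natSumNatEquivNat (Equiv.refl ℕ))
  have h1 := (dblP_mult x hp2 hq).hasProd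
  have h2 := (dblP_mult (x * p) hp2 hq).hasProd
  have key : HasProd ((fun jk : ℕ × ℕ => (1 - x * p ^ jk.1 * q ^ jk.2)) ∘ e)
      (dblP x (p ^ 2) q * dblP (x * p) (p ^ 2) q) := by
    refine HasProd.sum ?_ ?_
    · refine h1.congr_fun ?_
      intro jk
      simp [e, Equiv.natSumNatEquivNat_apply, pow_mul]
    · refine h2.congr_fun ?_
      intro jk
      simp [e, Equiv.natSumNatEquivNat_apply, pow_mul, pow_succ]
      left
      ring
  exact (e.hasProd_iff.1 key).tprod_eq

lemma dblP_sq (x : ℂ) {p q : ℂ} (hp : ‖p‖ < 1) (hq : ‖q‖ < 1) :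
    dblP (x ^ 2) (p ^ 2) (q ^ 2) = dblP x p q * dblP (-x) p q := by
  unfold dblP
  rw [← (dblP_mult x hp hq).tprod_mul (dblP_mult (-x) hp hq)]
  refine tprod_congr fun jk => ?_
  ring

lemma dblP_dup (x a b : ℂ) {p q : ℂ} (hp : ‖p‖ < 1) (hq : ‖q‖ < 1)
    (ha : a ^ 2 = p) (hb : b ^ 2 = q) :
    dblP (x ^ 2) p q = dblP x p q * dblP (-x) p q * dblP (b * x) p q * dblP (-(b * x)) p q *
        dblP (a * x) p q * dblP (-(a * x)) p q * dblP (a * b * x) p q *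
        dblP (-(a * b * x)) p q := by
  have hp2 : ‖p ^ 2‖ < 1 := by
    rw [norm_pow]; exact pow_lt_one₀ (norm_nonneg _) hp (by norm_num)
  have split2 : ∀ y, dblP y (p ^ 2) q =
      dblP y (p ^ 2) (q ^ 2) * dblP (y * q) (p ^ 2) (q ^ 2) := by
    intro y
    rw [dblP_swap, dblP_split y hq hp2, dblP_swap, dblP_swap (y * q)]
  rw [dblP_split _ hp hq, split2, split2,
    show x ^ 2 * q = (b * x) ^ 2 by rw [← hb]; ring,
    show x ^ 2 * p * q = (a * b * x) ^ 2 by rw [← hb, ← ha]; ring,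
    show x ^ 2 * p = (a * x) ^ 2 by rw [← ha]; ring,
    dblP_sq _ hp hq, dblP_sq _ hp hq, dblP_sq _ hp hq, dblP_sq _ hp hq]
  ring

lemma ellGamma_eq (z : ℂ) {p q : ℂ} (hp : ‖p‖ < 1) (hq : ‖q‖ < 1)
    (h : ∀ j k : ℕ, z * p ^ j * q ^ k ≠ 1) :
    ellGamma z p q = dblP (z⁻¹ * p * q) p q / dblP z p q := by
  unfold ellGamma
  have := (dblP_mult (z⁻¹ * p * q) hp hq).tprod_div₀ (dblP_mult z hp hq)
    (dblP_ne_zero z hp hq h)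
  unfold dblP
  rw [← this]
  refine tprod_congr fun jk => ?_
  congr 1
  ring

/-- The duplication formula for the elliptic gamma function: with `a² = p`,
`b² = q`, `Γ(z²;p,q) = Γ(z;p,q)Γ(-z;p,q)Γ(bz;p,q)Γ(-bz;p,q)Γ(az;p,q)Γ(-az;p,q)
Γ(abz;p,q)Γ(-abz;p,q)`. -/
theorem ellGamma_duplication (p q a b : ℂ) (hp : ‖p‖ < 1)
    (hq : ‖q‖ < 1) (ha : a ^ 2 = p) (hb : b ^ 2 = q)
    (z : ℂ) (hz : z ≠ 0)
    (hdef : ∀ w ∈ [z ^ 2, z, -z, b * z, -(b * z), a * z, -(a * z), a * b * z, -(a * b * z)],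
      ∀ j k : ℕ, w * p ^ j * q ^ k ≠ 1) :
    ellGamma (z ^ 2) p q =
      ellGamma z p q * ellGamma (-z) p q * ellGamma (b * z) p q * ellGamma (-(b * z)) p q *
        ellGamma (a * z) p q * ellGamma (-(a * z)) p q * ellGamma (a * b * z) p q *
        ellGamma (-(a * b * z)) p q := by
  have num : dblP ((z ^ 2)⁻¹ * p * q) p q = dblP (z⁻¹ * p * q) p q * dblP ((-z)⁻¹ * p * q) p q *
      dblP ((b * z)⁻¹ * p * q) p q * dblP ((-(b * z))⁻¹ * p * q) p q *
      dblP ((a * z)⁻¹ * p * q) p q * dblP ((-(a * z))⁻¹ * p * q) p q *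
      dblP ((a * b * z)⁻¹ * p * q) p q * dblP ((-(a * b * z))⁻¹ * p * q) p q := by
    have h0 : dblP 0 p q = 1 := by simp [dblP]
    rcases eq_or_ne a 0 with ha0 | ha0
    · have : p = 0 := by rw [← ha, ha0]; ring
      rw [this] at h0 ⊢
      simp [h0]
    rcases eq_or_ne b 0 with hb0 | hb0
    · have : q = 0 := by rw [← hb, hb0]; ring
      rw [this] at h0 ⊢
      simp [h0]
    have key := dblP_dup (a * b * z⁻¹) a b hp hq ha hb
    rw [show (z ^ 2)⁻¹ * p * q = (a * b * z⁻¹) ^ 2 by rw [← ha, ← hb]; field_simp, key,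
      show z⁻¹ * p * q = a * b * (a * b * z⁻¹) by rw [← ha, ← hb]; field_simp,
      show (-z)⁻¹ * p * q = -(a * b * (a * b * z⁻¹)) by rw [← ha, ← hb]; field_simp,
      show (b * z)⁻¹ * p * q = a * (a * b * z⁻¹) by rw [← ha, ← hb]; field_simp,
      show (-(b * z))⁻¹ * p * q = -(a * (a * b * z⁻¹)) by rw [← ha, ← hb]; field_simp,
      show (a * z)⁻¹ * p * q = b * (a * b * z⁻¹) by rw [← ha, ← hb]; field_simp,
      show (-(a * z))⁻¹ * p * q = -(b * (a * b * z⁻¹)) by rw [← ha, ← hb]; field_simp,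
      show (a * b * z)⁻¹ * p * q = a * b * z⁻¹ by rw [← ha, ← hb]; field_simp,
      show (-(a * b * z))⁻¹ * p * q = -(a * b * z⁻¹) by rw [← ha, ← hb]; field_simp]
    ring
  rw [ellGamma_eq _ hp hq (hdef (z ^ 2) (by simp)), ellGamma_eq _ hp hq (hdef z (by simp)),
    ellGamma_eq _ hp hq (hdef (-z) (by simp)), ellGamma_eq _ hp hq (hdef (b * z) (by simp)),
    ellGamma_eq _ hp hq (hdef (-(b * z)) (by simp)), ellGamma_eq _ hp hq (hdef (a * z) (by simp)),
    ellGamma_eq _ hp hq (hdef (-(a * z)) (by simp)),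
    ellGamma_eq _ hp hq (hdef (a * b * z) (by simp)),
    ellGamma_eq _ hp hq (hdef (-(a * b * z)) (by simp)), num, dblP_dup z a b hp hq ha hb]
  simp only [div_mul_div_comm]
end
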